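/- For any connected graph G, stc(G) ≥ min { θ_G(s) : ⌈(|V(G)| − 1)/Δ(G)⌉ ≤ s ≤ ⌊|V(G)|/2⌋ }, where the minimum is over integers s in that range. -/

import Mathlib

open SimpleGraph

/-- The boundary edge set `θ_G(S)`: edges of `G` with exactly one endpoint in `S`. -/
def boundaryEdges {V : Type*} (G : SimpleGraph V) (S : Set V) : Set (Sym2 V) :=
  {e | e ∈ G.edgeSet ∧ ∃ u v, e = s(u, v) ∧ u ∈ S ∧ v ∉ S}

/-- The congestion of the edge `{u,v}` of a spanning tree `T` of `G`:
the number of `G`-edges on the boundary of the component of `u` in `T - {u,v}`. -/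
noncomputable def edgeCongestion {V : Type*} (G T : SimpleGraph V) (u v : V) : ℕ :=
  (boundaryEdges G {w | (T.deleteEdges {s(u, v)}).Reachable u w}).ncard

/-- The congestion of a spanning tree `T` of `G`: maximum congestion over edges of `T`. -/
noncomputable def treeCongestion {V : Type*} (G T : SimpleGraph V) : ℕ :=
  sSup {c | ∃ u v, T.Adj u v ∧ c = edgeCongestion G T u v}

/-- The spanning tree congestion of `G`: minimum congestion over spanning trees of `G`. -/
noncomputable def stc {V : Type*} (G : SimpleGraph V) : ℕ :=
  sInf {c | ∃ T : SimpleGraph V, T ≤ G ∧ T.IsTree ∧ c = treeCongestion G T}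

/-- `θ_G(s)`: minimum of `|θ_G(S)|` over all vertex subsets of size `s`. -/
noncomputable def minBoundary {V : Type*} (G : SimpleGraph V) (s : ℕ) : ℕ :=
  sInf {c | ∃ S : Set V, S.ncard = s ∧ c = (boundaryEdges G S).ncard}

namespace SimpleGraph

variable {V : Type*}

/-- The vertex set of the component of `u` in `T - {u,v}`. -/
def edgeSide (T : SimpleGraph V) (u v : V) : Set V :=
  {w | (T.deleteEdges {s(u, v)}).Reachable u w}

theorem mem_edgeSide_self (T : SimpleGraph V) (u v : V) : u ∈ T.edgeSide u v :=
  Reachable.refl (G := T.deleteEdges {s(u, v)}) u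

theorem mem_edgeSide_of_adj {T : SimpleGraph V} {u v x y : V} (hx : x ∈ T.edgeSide u v)
    (h : T.Adj x y) (hne : s(x, y) ≠ s(u, v)) : y ∈ T.edgeSide u v :=
  Reachable.trans hx (Adj.reachable (deleteEdges_adj.mpr ⟨h, hne⟩))

theorem Reachable.induction_on {T : SimpleGraph V} {u x : V} (h : T.Reachable u x)
    {P : V → Prop} (hu : P u) (step : ∀ y z, T.Reachable u y → T.Adj y z → P y → P z) : P x := by
  rw [reachable_iff_reflTransGen] at h
  induction h with
  | refl => exact hu
  | tail hy hyz ih => exact step _ _ (by rwa [reachable_iff_reflTransGen]) hyz ih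

theorem IsAcyclic.notMem_edgeSide {T : SimpleGraph V} (hT : T.IsAcyclic) {u v : V}
    (h : T.Adj u v) : v ∉ T.edgeSide u v :=
  isBridge_iff.mp (isAcyclic_iff_forall_adj_isBridge.mp hT h)

theorem Connected.edgeSide_union {T : SimpleGraph V} (hT : T.Connected) (u v x : V) :
    x ∈ T.edgeSide u v ∨ x ∈ T.edgeSide v u := by
  refine (hT u x).induction_on (P := fun x => x ∈ T.edgeSide u v ∨ x ∈ T.edgeSide v u)
    (Or.inl (mem_edgeSide_self _ _ _)) fun y z _ hyz ih => ?_
  by_cases he : s(y, z) = s(u, v)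
  · rcases Sym2.eq_iff.mp he with ⟨-, rfl⟩ | ⟨-, rfl⟩
    · exact Or.inr (mem_edgeSide_self _ _ _)
    · exact Or.inl (mem_edgeSide_self _ _ _)
  · exact ih.imp (fun h => mem_edgeSide_of_adj h hyz he)
      (fun h => mem_edgeSide_of_adj h hyz (by rwa [Sym2.eq_swap (a := v)]))

theorem IsTree.edgeSide_compl {T : SimpleGraph V} (hT : T.IsTree) {u v : V} (h : T.Adj u v) :
    (T.edgeSide u v)ᶜ = T.edgeSide v u := by
  ext x
  refine ⟨fun hx => (hT.connected.edgeSide_union u v x).resolve_left hx, fun hx hx' => ?_⟩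
  refine hT.isAcyclic.notMem_edgeSide h (Reachable.trans hx' (Reachable.symm ?_))
  simpa [edgeSide, Sym2.eq_swap (a := v)] using hx

theorem IsAcyclic.edgeSide_ssubset {T : SimpleGraph V} (hT : T.IsAcyclic) {u v w : V}
    (hw : T.Adj u w) (hwv : w ≠ v) : T.edgeSide w u ⊂ T.edgeSide u v := by
  have hu := hT.notMem_edgeSide hw.symm
  refine (Set.ssubset_iff_of_subset fun x hx => ?_).mpr ⟨u, mem_edgeSide_self _ _ _, hu⟩
  refine Reachable.induction_on hx (P := fun x => x ∈ T.edgeSide u v)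
    (mem_edgeSide_of_adj (mem_edgeSide_self _ _ _) hw ?_) fun y z hy hyz ih => ?_
  · exact fun he => hwv (Sym2.congr_right.mp he)
  · have hz : z ∈ T.edgeSide w u := Reachable.trans hy hyz.reachable
    refine mem_edgeSide_of_adj ih ((deleteEdges_adj.mp hyz).1) fun he => ?_
    rcases Sym2.eq_iff.mp he with ⟨rfl, -⟩ | ⟨-, rfl⟩
    · exact hu hy
    · exact hu hz

theorem Connected.exists_adj_mem_edgeSide {T : SimpleGraph V} (hT : T.Connected) {u x : V}
    (hx : x ≠ u) : ∃ w, T.Adj u w ∧ x ∈ T.edgeSide w u := by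
  refine ((hT u x).induction_on (P := fun x => x = u ∨ ∃ w, T.Adj u w ∧ x ∈ T.edgeSide w u)
    (Or.inl rfl) fun y z _ hyz ih => ?_).resolve_left hx
  by_cases hz : z = u
  · exact Or.inl hz
  right
  by_cases hy : y = u
  · exact ⟨z, hy ▸ hyz, mem_edgeSide_self _ _ _⟩
  obtain ⟨w, hw, hyw⟩ := ih.resolve_left hy
  refine ⟨w, hw, mem_edgeSide_of_adj hyw hyz fun he => ?_⟩
  rcases Sym2.eq_iff.mp he with ⟨-, h⟩ | ⟨h, -⟩
  · exact hz h
  · exact hy h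

variable [Fintype V]

theorem IsTree.ncard_edgeSide_add {T : SimpleGraph V} (hT : T.IsTree) {u v : V}
    (h : T.Adj u v) : (T.edgeSide u v).ncard + (T.edgeSide v u).ncard = Fintype.card V := by
  rw [← hT.edgeSide_compl h, Set.ncard_add_ncard_compl, Nat.card_eq_fintype_card]

/-- A tree with an edge has a centroid: a vertex all of whose branches contain at most half of
the vertices. -/
theorem IsTree.exists_centroid {T : SimpleGraph V} (hT : T.IsTree) [Nontrivial V] :
    ∃ u, ∀ w, T.Adj u w → 2 * (T.edgeSide w u).ncard ≤ Fintype.card V := by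
  classical
  let s : Finset (V × V) := {p | T.Adj p.1 p.2 ∧
    Fintype.card V ≤ 2 * (T.edgeSide p.1 p.2).ncard}
  have hs : s.Nonempty := by
    obtain ⟨a⟩ := hT.connected.nonempty
    obtain ⟨b, hab⟩ := hT.connected.preconnected.exists_adj_of_nontrivial a
    have := hT.ncard_edgeSide_add hab
    by_cases h : Fintype.card V ≤ 2 * (T.edgeSide a b).ncard
    · exact ⟨(a, b), by simp [s, hab, h]⟩
    · refine ⟨(b, a), ?_⟩
      simp only [s, Finset.mem_filter, Finset.mem_univ, true_and]
      exact ⟨hab.symm, by omega⟩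
  obtain ⟨⟨u, v⟩, huv, hmin⟩ := s.exists_min_image (fun p => (T.edgeSide p.1 p.2).ncard) hs
  simp only [s, Finset.mem_filter, Finset.mem_univ, true_and] at huv hmin
  refine ⟨u, fun w hw => ?_⟩
  by_cases hwv : w = v
  · subst hwv
    have := hT.ncard_edgeSide_add hw
    omega
  · by_contra! hlt
    have h1 := hmin (w, u) ⟨hw.symm, hlt.le⟩
    have h2 := Set.ncard_lt_ncard (hT.isAcyclic.edgeSide_ssubset hw hwv) (Set.toFinite _)
    exact absurd h1 (not_le.mpr h2)

/-- A spanning tree `T` of `G` has an edge one of whose sides has at most half of the vertices,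
but at least a `1 / Δ(G)` fraction of all vertices but one. -/
theorem IsTree.exists_balanced_edge {G T : SimpleGraph V} [DecidableRel G.Adj] (hT : T.IsTree)
    (hTG : T ≤ G) [Nontrivial V] : ∃ u v, T.Adj u v ∧
      (Fintype.card V - 1) ⌈/⌉ G.maxDegree ≤ (T.edgeSide u v).ncard ∧
      (T.edgeSide u v).ncard ≤ Fintype.card V / 2 := by
  classical
  obtain ⟨u, hu⟩ := hT.exists_centroid
  let N : Finset V := {w | T.Adj u w}
  have hN : N.Nonempty := by
    obtain ⟨b, hab⟩ := hT.connected.preconnected.exists_adj_of_nontrivial u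
    exact ⟨b, by simpa [N] using hab⟩
  have hcard : N.card ≤ G.maxDegree :=
    (Finset.card_le_card fun w hw => by
      simpa using hTG (by simpa [N] using hw)).trans (G.degree_le_maxDegree u)
  obtain ⟨w, hwN, hmax⟩ := N.exists_max_image (fun w => (T.edgeSide w u).ncard) hN
  have hw : T.Adj u w := by simpa [N] using hwN
  refine ⟨w, u, hw.symm, ?_, by have := hu w hw; omega⟩
  rw [ceilDiv_le_iff_le_mul (hN.card_pos.trans_le hcard)]
  calc Fintype.card V - 1 = ({u}ᶜ : Set V).ncard := by
        rw [Set.ncard_compl, Set.ncard_singleton, Nat.card_eq_fintype_card]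
    _ ≤ (⋃ w ∈ N, T.edgeSide w u).ncard := by
        refine Set.ncard_le_ncard (fun x hx => ?_) (Set.toFinite _)
        obtain ⟨w, hw, hxw⟩ := hT.connected.exists_adj_mem_edgeSide (u := u) (x := x) hx
        simp only [Set.mem_iUnion]
        exact ⟨w, by simpa [N] using hw, hxw⟩
    _ ≤ ∑ w ∈ N, (T.edgeSide w u).ncard := N.set_ncard_biUnion_le _
    _ ≤ N.card * (T.edgeSide w u).ncard := by
        simpa using N.sum_le_card_nsmul _ _ hmax
    _ ≤ _ := by gcongr

theorem edgeCongestion_le_treeCongestion (G : SimpleGraph V) {T : SimpleGraph V} {u v : V}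
    (h : T.Adj u v) : edgeCongestion G T u v ≤ treeCongestion G T := by
  refine le_csSup ⟨Nat.card (Sym2 V), ?_⟩ ⟨u, v, h, rfl⟩
  rintro _ ⟨a, b, -, rfl⟩
  exact Set.ncard_le_card _

end SimpleGraph

/-- For any connected graph `G`,
`stc(G) ≥ min { θ_G(s) : ⌈(|V(G)|-1)/Δ(G)⌉ ≤ s ≤ ⌊|V(G)|/2⌋ }`. -/
theorem stc_ge_min_boundary {V : Type*} [Fintype V] (G : SimpleGraph V)
    [DecidableRel G.Adj] (hG : G.Connected) :
    sInf {c | ∃ s : ℕ, (Fintype.card V - 1) ⌈/⌉ G.maxDegree ≤ s ∧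
      s ≤ Fintype.card V / 2 ∧ c = minBoundary G s} ≤ stc G := by
  have hne : {c | ∃ T : SimpleGraph V, T ≤ G ∧ T.IsTree ∧ c = treeCongestion G T}.Nonempty := by
    obtain ⟨T, hTG, hT⟩ := hG.exists_isTree_le
    exact ⟨_, T, hTG, hT, rfl⟩
  obtain ⟨T, hTG, hT, hc⟩ := Nat.sInf_mem hne
  rw [stc, hc]
  rcases subsingleton_or_nontrivial V with hV | hV
  · have h0 : minBoundary G 0 = 0 :=
      Nat.sInf_eq_zero.mpr (Or.inl ⟨∅, by simp, by simp [boundaryEdges]⟩)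
    have hcard : Fintype.card V - 1 = 0 := by
      have := Fintype.card_le_one_iff_subsingleton.mpr hV
      omega
    have hzero : (Fintype.card V - 1) ⌈/⌉ G.maxDegree ≤ 0 := by simp [hcard]
    refine le_trans (Nat.sInf_le ?_) (Nat.zero_le _)
    exact ⟨0, hzero, Nat.zero_le _, h0.symm⟩
  · obtain ⟨u, v, huv, hlow, hhigh⟩ := hT.exists_balanced_edge hTG
    refine le_trans (Nat.sInf_le ⟨_, hlow, hhigh, rfl⟩) ?_
    calc minBoundary G (T.edgeSide u v).ncard
      _ ≤ edgeCongestion G T u v := Nat.sInf_le ⟨_, rfl, rfl⟩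
      _ ≤ treeCongestion G T := edgeCongestion_le_treeCongestion G huv
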